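/- arXiv:2506.20925 — 2 statements merged into one kernel-verified Lean document; each statement's English description precedes it below -/
import Mathlib

section
/- Let μ and ν be Borel probability measures on [0, ∞) with CDFs F and G satisfying G(v) ≤ F(v) for all v (ν first-order stochastically dominates μ), and let c ≥ 0. Then the supremum over all couplings ρ of (μ, ν) of ∫ max(min{x, y} − c, 0) dρ(x, y) equals ∫ max(v − c, 0) dμ(v), and the supremum is attained by the comonotone coupling, i.e. the pushforward of Lebesgue measure on (0,1) under q ↦ (F⁻¹(q), G⁻¹(q)). -/
open MeasureTheory Set Filter

noncomputable section

/-- The cumulative distribution function of a Borel measure on `ℝ`. -/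
def mCdf (μ : Measure ℝ) (v : ℝ) : ℝ := (μ (Iic v)).toReal

/-- Total variation distance between two measures on `ℝ`:
the supremum over Borel sets `A` of `|μ A - ν A|`. -/
def tvDist (μ ν : Measure ℝ) : ℝ :=
  sSup {x : ℝ | ∃ A : Set ℝ, MeasurableSet A ∧ x = |(μ A).toReal - (ν A).toReal|}

/-- Generalized inverse of a CDF: `F⁻¹ q = inf {v | q ≤ F v}`. -/
def invCdf (F : ℝ → ℝ) (q : ℝ) : ℝ := sInf {v : ℝ | q ≤ F v}

/-- `ρ` is a coupling of `(μ, ν)` iff its marginals are `μ` and `ν`. -/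
def IsCoupling (μ ν : Measure ℝ) (ρ : Measure (ℝ × ℝ)) : Prop :=
  ρ.fst = μ ∧ ρ.snd = ν

/-- The market primitives: probability measures `μl, μh` on `ℝ` with densities
`fl, fh` positive exactly on a common interval `(vlo, vhi)` (with `vhi` possibly `∞`),
and a strictly increasing likelihood ratio `fh / fl` on that interval. -/
structure MarketData where
  μl : Measure ℝ
  μh : Measure ℝ
  fl : ℝ → ℝ
  fh : ℝ → ℝ
  vlo : ℝ
  vhi : EReal
  probl : IsProbabilityMeasure μl
  probh : IsProbabilityMeasure μh
  meas_fl : Measurable fl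
  meas_fh : Measurable fh
  dens_l : μl = volume.withDensity (fun v => ENNReal.ofReal (fl v))
  dens_h : μh = volume.withDensity (fun v => ENNReal.ofReal (fh v))
  vlo_nonneg : 0 ≤ vlo
  vlo_lt_vhi : (vlo : EReal) < vhi
  fl_nonneg : ∀ v, 0 ≤ fl v
  fh_nonneg : ∀ v, 0 ≤ fh v
  fl_pos_iff : ∀ v : ℝ, 0 < fl v ↔ (vlo < v ∧ (v : EReal) < vhi)
  fh_pos_iff : ∀ v : ℝ, 0 < fh v ↔ (vlo < v ∧ (v : EReal) < vhi)
  lr_strictMono : StrictMonoOn (fun v => fh v / fl v) {v : ℝ | vlo < v ∧ (v : EReal) < vhi}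

/-- CDF of the `l`-group. -/
def MarketData.Fl (D : MarketData) : ℝ → ℝ := mCdf D.μl

/-- CDF of the `h`-group. -/
def MarketData.Fh (D : MarketData) : ℝ → ℝ := mCdf D.μh

/-- `Δ v = F_l v − F_h v`. -/
def MarketData.Δ (D : MarketData) (v : ℝ) : ℝ := D.Fl v - D.Fh v

/-- `vstar` is the unique maximizer of `Δ`, characterized by `f_l vstar = f_h vstar`. -/
def IsVStar (D : MarketData) (vstar : ℝ) : Prop :=
  D.fl vstar = D.fh vstar ∧ (∀ v, D.Δ v ≤ D.Δ vstar) ∧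
  (∀ v, (∀ w, D.Δ w ≤ D.Δ v) → v = vstar)

/-- A vector `κ = (κ¹, κ², κ³, κ⁴, κ⁵) ∈ ℝ⁵`. -/
structure Kappa where
  k1 : ℝ
  k2 : ℝ
  k3 : ℝ
  k4 : ℝ
  k5 : ℝ

/-- The κ-system at `(c, α)` for the pair of CDFs `(Fl, Fh)`:
`κ¹ ≤ κ² ≤ κ³ ≤ κ⁴ ≤ κ⁵`,
`κ² = Fl⁻¹(Δ κ³ + Fh κ¹) = Fl⁻¹(Δ κ⁴) = Fl⁻¹(Δ κ⁵)` and
`κ¹ − c = (1 − α)(κ³ − c) = α (κ⁵ − κ⁴)`. -/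
def KappaSystem (Fl Fh : ℝ → ℝ) (c α : ℝ) (κ : Kappa) : Prop :=
  κ.k1 ≤ κ.k2 ∧ κ.k2 ≤ κ.k3 ∧ κ.k3 ≤ κ.k4 ∧ κ.k4 ≤ κ.k5 ∧
  κ.k2 = invCdf Fl ((Fl κ.k3 - Fh κ.k3) + Fh κ.k1) ∧
  κ.k2 = invCdf Fl (Fl κ.k4 - Fh κ.k4) ∧
  κ.k2 = invCdf Fl (Fl κ.k5 - Fh κ.k5) ∧
  κ.k1 - c = (1 - α) * (κ.k3 - c) ∧
  κ.k1 - c = α * (κ.k5 - κ.k4)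

/-- The pairwise profit from a matched pair `(v_l, v_h)`:
`max { min{v_l,v_h} − c, α(v_h − c)⁺, (1−α)(v_l − c)⁺ }`. -/
def pairProfit (c α vl vh : ℝ) : ℝ :=
  max (min vl vh - c) (max (α * max (vh - c) 0) ((1 - α) * max (vl - c) 0))

/-- The set of matched-pair profit values achievable by couplings of `(μl, μh)`. -/
def couplingValues (μl μh : Measure ℝ) (c α : ℝ) : Set ℝ :=
  {x : ℝ | ∃ ρ : Measure (ℝ × ℝ), IsCoupling μl μh ρ ∧
    x = ∫ p, pairProfit c α p.1 p.2 ∂ρ}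

theorem mCdf_eq_cdf (μ : Measure ℝ) [IsProbabilityMeasure μ] (v : ℝ) :
    mCdf μ v = ProbabilityTheory.cdf μ v :=
  (ProbabilityTheory.cdf_eq_real μ v).symm

/-- The Galois connection between a CDF and its generalized inverse. -/
theorem invCdf_mCdf_le_iff (μ : Measure ℝ) [IsProbabilityMeasure μ] {q : ℝ}
    (hq : q ∈ Ioo (0 : ℝ) 1) (x : ℝ) : invCdf (mCdf μ) q ≤ x ↔ q ≤ mCdf μ x := by
  simp only [invCdf, mCdf_eq_cdf]
  have hmono := ProbabilityTheory.monotone_cdf μ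
  constructor
  · intro h
    by_contra! hlt
    have hright := ((ProbabilityTheory.cdf μ).right_continuous x).mono Ioi_subset_Ici_self
    obtain ⟨y, hyq, hxy⟩ :=
      ((hright.eventually_lt_const hlt).and self_mem_nhdsWithin).exists
    obtain ⟨z, hz⟩ :=
      ((ProbabilityTheory.tendsto_cdf_atTop μ).eventually_const_lt hq.2).exists
    have hy : y ≤ sInf {v | q ≤ ProbabilityTheory.cdf μ v} :=
      le_csInf ⟨z, hz.le⟩ fun v hv ↦ (hmono.reflect_lt (hyq.trans_le hv)).le
    exact absurd (hy.trans h) (not_le.2 hxy)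
  · intro h
    obtain ⟨y, hy⟩ :=
      ((ProbabilityTheory.tendsto_cdf_atBot μ).eventually_lt_const hq.1).exists
    exact csInf_le ⟨y, fun v hv ↦ (hmono.reflect_lt (hy.trans_le hv)).le⟩ h

theorem monotoneOn_invCdf_mCdf (μ : Measure ℝ) [IsProbabilityMeasure μ] :
    MonotoneOn (invCdf (mCdf μ)) (Ioo 0 1) := fun _ ha _ hb hab ↦
  (invCdf_mCdf_le_iff μ ha _).2 (hab.trans ((invCdf_mCdf_le_iff μ hb _).1 le_rfl))

theorem aemeasurable_invCdf_mCdf (μ : Measure ℝ) [IsProbabilityMeasure μ] :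
    AEMeasurable (invCdf (mCdf μ)) (volume.restrict (Ioo (0 : ℝ) 1)) :=
  aemeasurable_restrict_of_monotoneOn measurableSet_Ioo (monotoneOn_invCdf_mCdf μ)

/-- The quantile transform: the generalized inverse of the CDF of `μ` pushes the uniform
distribution on `(0, 1)` forward to `μ`. -/
theorem map_invCdf_mCdf (μ : Measure ℝ) [IsProbabilityMeasure μ] :
    (volume.restrict (Ioo (0 : ℝ) 1)).map (invCdf (mCdf μ)) = μ := by
  have : IsFiniteMeasure ((volume.restrict (Ioo (0 : ℝ) 1)).map (invCdf (mCdf μ))) :=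
    Measure.isFiniteMeasure_map _ _
  refine Measure.ext_of_Iic _ _ fun x ↦ ?_
  rw [Measure.map_apply_of_aemeasurable (aemeasurable_invCdf_mCdf μ) measurableSet_Iic,
    Measure.restrict_apply' measurableSet_Ioo]
  have hset : invCdf (mCdf μ) ⁻¹' Iic x ∩ Ioo 0 1 = Iic (mCdf μ x) ∩ Ioo 0 1 := by
    ext q
    exact and_congr_left fun hq ↦ invCdf_mCdf_le_iff μ hq x
  have hle : mCdf μ x ≤ 1 := by
    rw [mCdf_eq_cdf]
    exact ProbabilityTheory.cdf_le_one μ x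
  have hae : (Iic (mCdf μ x) ∩ Ioo 0 1 : Set ℝ) =ᵐ[volume] Ioc 0 (mCdf μ x) := by
    rw [inter_comm, ← min_eq_right hle, ← Ioc_inter_Iic, min_eq_right hle]
    exact Ioo_ae_eq_Ioc.inter (ae_eq_refl _)
  rw [hset, measure_congr hae, Real.volume_Ioc, sub_zero, mCdf,
    ENNReal.ofReal_toReal (measure_ne_top μ _)]

/-- The comonotone pushforward of the uniform distribution is a coupling. -/
theorem isCoupling_comonotone (μ ν : Measure ℝ) [IsProbabilityMeasure μ]
    [IsProbabilityMeasure ν] :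
    IsCoupling μ ν ((volume.restrict (Ioo (0 : ℝ) 1)).map
      (fun q => (invCdf (mCdf μ) q, invCdf (mCdf ν) q))) :=
  ⟨(Measure.fst_map_prodMk₀ (aemeasurable_invCdf_mCdf ν)).trans (map_invCdf_mCdf μ),
    (Measure.snd_map_prodMk₀ (aemeasurable_invCdf_mCdf μ)).trans (map_invCdf_mCdf ν)⟩

/-- First-order stochastic dominance orders the generalized inverses. -/
theorem invCdf_mCdf_le_of_dom {μ ν : Measure ℝ} [IsProbabilityMeasure μ]
    [IsProbabilityMeasure ν] (hdom : ∀ v : ℝ, mCdf ν v ≤ mCdf μ v) {q : ℝ}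
    (hq : q ∈ Ioo (0 : ℝ) 1) : invCdf (mCdf μ) q ≤ invCdf (mCdf ν) q :=
  (invCdf_mCdf_le_iff μ hq _).2 (((invCdf_mCdf_le_iff ν hq _).1 le_rfl).trans (hdom _))

theorem IsCoupling.lintegral_fst {μ ν : Measure ℝ} {ρ : Measure (ℝ × ℝ)}
    (h : IsCoupling μ ν ρ) {f : ℝ → ENNReal} (hf : Measurable f) :
    ∫⁻ p, f p.1 ∂ρ = ∫⁻ v, f v ∂μ := by
  rw [← h.1, Measure.fst, lintegral_map hf measurable_fst]

/-- if `ν` first-order stochastically dominates `μ` (both supported on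
`[0, ∞)`), the supremum over couplings of `∫ (min{x,y} − c)⁺ dρ` equals
`∫ (v − c)⁺ dμ`, and is attained by the comonotone coupling
`q ↦ (F⁻¹(q), G⁻¹(q))` of the uniform distribution on `(0,1)`. -/
theorem stmt13 (μ ν : Measure ℝ) [IsProbabilityMeasure μ] [IsProbabilityMeasure ν]
    (hμpos : μ (Iio 0) = 0) (hνpos : ν (Iio 0) = 0)
    (c : ℝ) (hc : 0 ≤ c)
    (hdom : ∀ v : ℝ, mCdf ν v ≤ mCdf μ v) :
    sSup {x : ENNReal | ∃ ρ : Measure (ℝ × ℝ), IsCoupling μ ν ρ ∧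
        x = ∫⁻ p, ENNReal.ofReal (max (min p.1 p.2 - c) 0) ∂ρ} =
      ∫⁻ v, ENNReal.ofReal (max (v - c) 0) ∂μ ∧
    IsCoupling μ ν ((volume.restrict (Ioo (0 : ℝ) 1)).map
        (fun q => (invCdf (mCdf μ) q, invCdf (mCdf ν) q))) ∧
    ∫⁻ p, ENNReal.ofReal (max (min p.1 p.2 - c) 0)
        ∂((volume.restrict (Ioo (0 : ℝ) 1)).map
          (fun q => (invCdf (mCdf μ) q, invCdf (mCdf ν) q))) =
      ∫⁻ v, ENNReal.ofReal (max (v - c) 0) ∂μ := by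
  have hcoup := isCoupling_comonotone μ ν
  have hmeas : Measurable fun v : ℝ => ENNReal.ofReal (max (v - c) 0) := by fun_prop
  have hval : ∫⁻ p, ENNReal.ofReal (max (min p.1 p.2 - c) 0)
        ∂((volume.restrict (Ioo (0 : ℝ) 1)).map
          (fun q => (invCdf (mCdf μ) q, invCdf (mCdf ν) q))) =
      ∫⁻ v, ENNReal.ofReal (max (v - c) 0) ∂μ := by
    rw [← hcoup.lintegral_fst hmeas]
    refine lintegral_congr_ae ?_
    have hle : ∀ᵐ p ∂((volume.restrict (Ioo (0 : ℝ) 1)).map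
        (fun q => (invCdf (mCdf μ) q, invCdf (mCdf ν) q))), p.1 ≤ p.2 := by
      rw [ae_map_iff ((aemeasurable_invCdf_mCdf μ).prodMk (aemeasurable_invCdf_mCdf ν))
        (measurableSet_le measurable_fst measurable_snd)]
      filter_upwards [ae_restrict_mem measurableSet_Ioo] with q hq
      exact invCdf_mCdf_le_of_dom hdom hq
    filter_upwards [hle] with p hp
    rw [min_eq_left hp]
  refine ⟨le_antisymm (sSup_le ?_) (le_sSup ⟨_, hcoup, hval.symm⟩), hcoup, hval⟩
  rintro _ ⟨ρ, hρ, rfl⟩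
  rw [← hρ.lintegral_fst hmeas]
  refine lintegral_mono fun p ↦ ENNReal.ofReal_le_ofReal ?_
  gcongr
  exact min_le_left _ _
end
end

section
/- Let c ≥ 0, α ∈ (0,1), and real numbers κ¹, κ³, κ⁴, κ⁵ with c < κ¹ ≤ κ³ ≤ κ⁴ ≤ κ⁵ satisfying κ¹ − c = (1−α)·(κ³ − c) = α·(κ⁵ − κ⁴). Then the set {(v_l, v_h) ∈ [0,∞)² : φ⋆(v_l) + ψ⋆(v_h) = π(v_l, v_h)} is contained in the union of the following six sets: [0, κ³] × [κ⁵, ∞); {(v_l, v_h) ∈ [κ¹, κ³] × [κ¹, κ³] : v_l ≥ v_h}; [κ³, κ⁴] × [0, κ¹]; {(v, v) : v ∈ [κ³, κ⁴]}; {(v_l, v_h) ∈ [κ⁴, κ⁵] × [κ⁴, κ⁵] : v_l ≤ v_h}; and {(v, v) : v ∈ [κ⁵, ∞)}. -/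
open MeasureTheory Set Filter

noncomputable section

/-- The dual variable `φ⋆`. -/
def phiStar (c α k1 k3 k4 k5 : ℝ) (vl : ℝ) : ℝ :=
  if vl ≤ k3 then k1 - c
  else if vl ≤ k4 then (1 - α) * (vl - c)
  else if vl ≤ k5 then vl - c - α * (k4 - c)
  else (1 - α) * (vl - c) + (k1 - c)

/-- The dual variable `ψ⋆`. -/
def psiStar (c α k1 k3 k4 k5 : ℝ) (vh : ℝ) : ℝ :=
  if vh ≤ k1 then 0
  else if vh ≤ k3 then vh - k1
  else if vh ≤ k4 then α * (vh - c)
  else if vh ≤ k5 then α * (k4 - c)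
  else α * (vh - c) - (k1 - c)

/-- For a weight `α ∈ (0, 1)`, both `v ↦ α * v` and `v ↦ (1 - α) * v` preserve and reflect the
strict order between `u` and `v`. -/
lemma weighted_lt_iff {α : ℝ} (hα0 : 0 < α) (hα1 : α < 1) (u v : ℝ) :
    ((α * u < α * v ↔ u < v) ∧ (α * v < α * u ↔ v < u)) ∧
      (u - α * u < v - α * v ↔ u < v) ∧ (v - α * v < u - α * u ↔ v < u) := by
  have h (u v : ℝ) : u - α * u < v - α * v ↔ u < v := by
    simpa only [sub_mul, one_mul] using mul_lt_mul_iff_right₀ (b := u) (c := v) (sub_pos.2 hα1)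
  exact ⟨⟨mul_lt_mul_iff_right₀ hα0, mul_lt_mul_iff_right₀ hα0⟩, h u v, h v u⟩

/-- the contact set of the dual pair `(φ⋆, ψ⋆)` is contained in the
union of the six regions describing the optimal matching. -/
theorem stmt14 (c α : ℝ) (hc : 0 ≤ c) (hα : α ∈ Ioo (0 : ℝ) 1)
    (k1 k3 k4 k5 : ℝ)
    (hck1 : c < k1) (h13 : k1 ≤ k3) (h34 : k3 ≤ k4) (h45 : k4 ≤ k5)
    (e1 : k1 - c = (1 - α) * (k3 - c)) (e2 : k1 - c = α * (k5 - k4)) :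
    {p : ℝ × ℝ | p ∈ Ici (0 : ℝ) ×ˢ Ici (0 : ℝ) ∧
        phiStar c α k1 k3 k4 k5 p.1 + psiStar c α k1 k3 k4 k5 p.2 =
          pairProfit c α p.1 p.2} ⊆
      (Icc 0 k3 ×ˢ Ici k5) ∪
      {p : ℝ × ℝ | p ∈ Icc k1 k3 ×ˢ Icc k1 k3 ∧ p.2 ≤ p.1} ∪
      (Icc k3 k4 ×ˢ Icc 0 k1) ∪
      {p : ℝ × ℝ | p.1 = p.2 ∧ p.1 ∈ Icc k3 k4} ∪
      {p : ℝ × ℝ | p ∈ Icc k4 k5 ×ˢ Icc k4 k5 ∧ p.1 ≤ p.2} ∪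
      {p : ℝ × ℝ | p.1 = p.2 ∧ k5 ≤ p.1} := by
  obtain ⟨hα0, hα1⟩ := hα
  rintro ⟨x, y⟩ ⟨⟨hx, hy⟩, h⟩
  simp only [mem_Ici] at hx hy
  simp only [mem_union, mem_prod, mem_ofPred_eq, mem_Icc, mem_Ici, or_assoc]
  have hk3 : k1 < k3 := by nlinarith
  have hk5 : k4 < k5 := by nlinarith
  have hp : x ⊓ y - c = pairProfit c α x y ∨ (c < y ∧ α * (y - c) = pairProfit c α x y) ∨
      (c < x ∧ (1 - α) * (x - c) = pairProfit c α x y) ∨ pairProfit c α x y = 0 := by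
    unfold pairProfit
    grind
  have hxy := weighted_lt_iff hα0 hα1 x y
  have hxc := weighted_lt_iff hα0 hα1 x c
  have hx3 := weighted_lt_iff hα0 hα1 x k3
  have hx4 := weighted_lt_iff hα0 hα1 x k4
  have hx5 := weighted_lt_iff hα0 hα1 x k5
  have hyc := weighted_lt_iff hα0 hα1 y c
  have hy1 := weighted_lt_iff hα0 hα1 y k1
  have hy3 := weighted_lt_iff hα0 hα1 y k3
  have hy4 := weighted_lt_iff hα0 hα1 y k4
  have hy5 := weighted_lt_iff hα0 hα1 y k5
  have h1c := weighted_lt_iff hα0 hα1 k1 c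
  have h31 := weighted_lt_iff hα0 hα1 k3 k1
  have h43 := weighted_lt_iff hα0 hα1 k4 k3
  have h54 := weighted_lt_iff hα0 hα1 k5 k4
  rw [← h] at hp
  clear h
  simp only [phiStar, psiStar] at hp
  split_ifs at hp <;> rcases min_cases x y with ⟨hm, _⟩ | ⟨hm, _⟩ <;> rw [hm] at hp <;> clear hm <;>
    rcases hp with hp | ⟨_, hp⟩ | ⟨_, hp⟩ | hp <;> grind
end
end
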